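/- arXiv:1606.08979 — 5 statements merged into one kernel-verified Lean document; each statement's English description precedes it below -/
import Mathlib

section
/- Let g be an automorphism of 𝔤 = 𝔤₁ ⊕ 𝔤₂ ⊕ 𝔤₃ such that g³ = id, g(𝔤₁) = 𝔤₂, g(𝔤₂) = 𝔤₃ and g(𝔤₃) = 𝔤₁, and let f be an automorphism of 𝔤 preserving the summands. If (f ∘ g)³ = id, then there exists an automorphism x of 𝔤 preserving the summands such that x ∘ g ∘ x⁻¹ = f ∘ g. (This is the paper's Lemma on conjugating f·g to g: there, the 𝔤ᵢ are isomorphic reductive Lie algebras and f is an inner automorphism; any inner automorphism of the direct sum preserves the summands, so this statement covers that case.) -/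
open DirectSum

section Glue

variable {K ι : Type*} [CommRing K] {L : ι → Type*}
  [∀ i, LieRing (L i)] [∀ i, LieAlgebra K (L i)]

/-- The `i`-th summand of a direct sum, as a set. -/
def summand (L : ι → Type*) [∀ i, LieRing (L i)] (i : ι) : Set (⨁ i, L i) :=
  {v | ∀ j ≠ i, v j = 0}

theorem of_mem_summand [DecidableEq ι] (i : ι) (a : L i) : DirectSum.of L i a ∈ summand L i :=
  fun _ hj => DirectSum.of_eq_of_ne _ _ a hj

/-- A map preserving the summands acts componentwise. -/
theorem apply_component_congr [DecidableEq ι] {A : (⨁ i, L i) ≃ₗ⁅K⁆ (⨁ i, L i)}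
    (hA : ∀ i, A '' summand L i = summand L i) {i : ι} {v w : ⨁ i, L i} (h : v i = w i) :
    A v i = A w i := by
  have key (u : ⨁ i, L i) : A u i = A (DirectSum.of L i (u i)) i := by
    induction u using DirectSum.induction_on with
    | zero => simp
    | of j a =>
      by_cases hij : j = i
      · subst hij
        simp
      · have hmem : A (DirectSum.of L j a) ∈ summand L j :=
          hA j ▸ Set.mem_image_of_mem A (of_mem_summand j a)
        rw [hmem i (Ne.symm hij), DirectSum.of_eq_of_ne _ _ a (Ne.symm hij)]
        simp
    | add u u' hu hu' => simp [hu, hu']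
  rw [key v, key w, h]

theorem symm_image_summand {A : (⨁ i, L i) ≃ₗ⁅K⁆ (⨁ i, L i)}
    (hA : ∀ i, A '' summand L i = summand L i) (i : ι) :
    A.symm '' summand L i = summand L i := by
  conv_lhs => rw [← hA i]
  simp [Set.image_image]

variable [Fintype ι] [DecidableEq ι]

/-- Gluing the `i`-th components of automorphisms `A i` preserving the summands. -/
def glue (A : ι → (⨁ i, L i) ≃ₗ⁅K⁆ (⨁ i, L i))
    (hA : ∀ k i, A k '' summand L i = summand L i) : (⨁ i, L i) ≃ₗ⁅K⁆ (⨁ i, L i) where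
  toFun v := DFinsupp.equivFunOnFintype.symm fun i => A i v i
  invFun v := DFinsupp.equivFunOnFintype.symm fun i => (A i).symm v i
  map_add' v w := by
    refine DFinsupp.ext fun i => ?_
    change A i (v + w) i = A i v i + A i w i
    simp
  map_smul' c v := by
    refine DFinsupp.ext fun i => ?_
    change A i (c • v) i = c • A i v i
    rw [map_smul, DirectSum.smul_apply]
  map_lie' {v w} := by
    refine DFinsupp.ext fun i => ?_
    change A i ⁅v, w⁆ i = ⁅_, _⁆
    rw [LieEquiv.map_lie, DirectSum.bracket_apply]
    rfl
  left_inv v := by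
    refine DFinsupp.ext fun i => ?_
    refine (apply_component_congr (symm_image_summand (hA i)) (i := i)
      (v := DFinsupp.equivFunOnFintype.symm fun i => A i v i) (w := A i v) rfl).trans ?_
    rw [LieEquiv.symm_apply_apply]
  right_inv v := by
    refine DFinsupp.ext fun i => ?_
    refine (apply_component_congr (hA i) (i := i)
      (v := DFinsupp.equivFunOnFintype.symm fun i => (A i).symm v i) (w := (A i).symm v) rfl).trans ?_
    rw [LieEquiv.apply_symm_apply]

theorem glue_apply_of_mem {A : ι → (⨁ i, L i) ≃ₗ⁅K⁆ (⨁ i, L i)}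
    (hA : ∀ k i, A k '' summand L i = summand L i) {i : ι} {v : ⨁ i, L i}
    (hv : v ∈ summand L i) : glue A hA v = A i v := by
  have hmem (k : ι) : A k v ∈ summand L i := hA k i ▸ Set.mem_image_of_mem (A k) hv
  refine DFinsupp.ext fun j => ?_
  change A j v j = A i v j
  by_cases hj : j = i
  · rw [hj]
  · rw [hmem j j hj, hmem i j hj]

theorem glue_image_summand {A : ι → (⨁ i, L i) ≃ₗ⁅K⁆ (⨁ i, L i)}
    (hA : ∀ k i, A k '' summand L i = summand L i) (i : ι) :
    glue A hA '' summand L i = summand L i :=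
  (Set.image_congr fun _ hv => glue_apply_of_mem hA hv).trans (hA i i)

end Glue

/-- Let `𝔤 = 𝔤₁ ⊕ 𝔤₂ ⊕ 𝔤₃` be a direct sum of Lie algebras over a
field `K`, and let `g` be an automorphism of `𝔤` with `g³ = id` cyclically permuting the
three summands, `g(𝔤₁) = 𝔤₂`, `g(𝔤₂) = 𝔤₃`, `g(𝔤₃) = 𝔤₁`.  Let `f` be an automorphism of
`𝔤` preserving the summands.  If `(f ∘ g)³ = id`, then there is an automorphism `x` of `𝔤`
preserving the summands such that `x ∘ g ∘ x⁻¹ = f ∘ g`. -/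
theorem statement_0 (K : Type*) [Field K] (L : Fin 3 → Type*)
    [∀ i, LieRing (L i)] [∀ i, LieAlgebra K (L i)]
    (g f : (⨁ i, L i) ≃ₗ⁅K⁆ (⨁ i, L i))
    (hg3 : ∀ v, g (g (g v)) = v)
    (hg12 : g '' {v : ⨁ i, L i | ∀ j ≠ 0, v j = 0} = {v : ⨁ i, L i | ∀ j ≠ 1, v j = 0})
    (hg23 : g '' {v : ⨁ i, L i | ∀ j ≠ 1, v j = 0} = {v : ⨁ i, L i | ∀ j ≠ 2, v j = 0})
    (hg31 : g '' {v : ⨁ i, L i | ∀ j ≠ 2, v j = 0} = {v : ⨁ i, L i | ∀ j ≠ 0, v j = 0})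
    (hf : ∀ i : Fin 3,
      f '' {v : ⨁ i', L i' | ∀ j ≠ i, v j = 0} = {v : ⨁ i', L i' | ∀ j ≠ i, v j = 0})
    (hfg3 : ∀ v, f (g (f (g (f (g v))))) = v) :
    ∃ x : (⨁ i, L i) ≃ₗ⁅K⁆ (⨁ i, L i),
      (∀ i : Fin 3,
        x '' {v : ⨁ i', L i' | ∀ j ≠ i, v j = 0} = {v : ⨁ i', L i' | ∀ j ≠ i, v j = 0}) ∧
      ∀ v, x (g (x.symm v)) = f (g v) := by
  have hg (i : Fin 3) : g '' summand L i = summand L (i + 1) := by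
    fin_cases i
    exacts [hg12, hg23, hg31]
  have hh (i : Fin 3) : (g.trans f) '' summand L i = summand L (i + 1) := by
    have hcomp : ⇑(g.trans f) = f ∘ g := rfl
    rw [hcomp, Set.image_comp, hg]
    exact hf (i + 1)
  let A : Fin 3 → (⨁ i, L i) ≃ₗ⁅K⁆ (⨁ i, L i) :=
    ![LieEquiv.refl, (g.trans g).trans (g.trans f), (g.trans (g.trans f)).trans (g.trans f)]
  have hA (k i : Fin 3) : A k '' summand L i = summand L i := by
    have hcycle : i + 1 + 1 + 1 = i := by
      fin_cases i <;> rfl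
    fin_cases k
    · exact Set.image_id _
    · change (g.trans f ∘ g ∘ g) '' _ = _
      rw [Set.image_comp, Set.image_comp, hg, hg, hh, hcycle]
    · change (g.trans f ∘ g.trans f ∘ g) '' _ = _
      rw [Set.image_comp, Set.image_comp, hg, hh, hh, hcycle]
  refine ⟨glue A hA, glue_image_summand hA, fun v => ?_⟩
  have key (u : ⨁ i, L i) : glue A hA (g u) = f (g (glue A hA u)) := by
    induction u using DirectSum.induction_on with
    | zero => simp
    | of i a =>
      have hu := of_mem_summand (L := L) i a
      generalize DirectSum.of L i a = u at hu
      rw [glue_apply_of_mem hA hu,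
        glue_apply_of_mem hA (hg i ▸ Set.mem_image_of_mem g hu)]
      fin_cases i
      · exact congrArg (fun w => f (g w)) (hg3 u)
      · rfl
      · exact (hfg3 (g u)).symm
    | add u w hu hw => simp only [map_add, hu, hw]
  rw [key, LieEquiv.apply_symm_apply]
end

section
/- The congruence subgroup Γ₀(3) is generated by T and S T³ S; that is, Γ₀(3) equals the subgroup of SL(2,ℤ) generated by the two matrices [[1,1],[0,1]] and [[−1,0],[3,−1]] (note that S T³ S = [[−1,0],[3,−1]]). -/
open Matrix MatrixGroups CongruenceSubgroup

/-- The matrix `T = [[1,1],[0,1]]` as an element of `SL(2, ℤ)`. -/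
def Tmat : SL(2, ℤ) := ⟨!![1, 1; 0, 1], by norm_num [Matrix.det_fin_two_of]⟩

/-- The matrix `S T³ S = [[-1,0],[3,-1]]` as an element of `SL(2, ℤ)`. -/
def STTTS : SL(2, ℤ) := ⟨!![-1, 0; 3, -1], by norm_num [Matrix.det_fin_two_of]⟩

theorem coe_Tmat : (Tmat : Matrix (Fin 2) (Fin 2) ℤ) = !![1, 1; 0, 1] := rfl

theorem coe_STTTS : (STTTS : Matrix (Fin 2) (Fin 2) ℤ) = !![-1, 0; 3, -1] := rfl

theorem mul_apply_zero (k g : SL(2, ℤ)) (i : Fin 2) :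
    (k * g) i 0 = k i 0 * g 0 0 + k i 1 * g 1 0 :=
  Matrix.mul_apply.trans (Fin.sum_univ_two _)

theorem Tmat_eq_modularGroup_T : Tmat = ModularGroup.T := rfl

theorem neg_one_eq_Tmat_mul_STTTS_pow_three : (-1 : SL(2, ℤ)) = (Tmat * STTTS) ^ 3 := by
  ext i j
  fin_cases i <;> fin_cases j <;> rfl

theorem neg_mem_closure_iff {g : SL(2, ℤ)} :
    -g ∈ Subgroup.closure {Tmat, STTTS} ↔ g ∈ Subgroup.closure {Tmat, STTTS} := by
  have hT : Tmat ∈ Subgroup.closure {Tmat, STTTS} := Subgroup.subset_closure (by simp)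
  have hV : STTTS ∈ Subgroup.closure {Tmat, STTTS} := Subgroup.subset_closure (by simp)
  rw [← neg_one_mul, neg_one_eq_Tmat_mul_STTTS_pow_three]
  exact Subgroup.mul_mem_cancel_left _ (pow_mem (mul_mem hT hV) 3)

theorem eq_T_zpow_of_upper_unipotent {g : SL(2, ℤ)} (ha : g 0 0 = 1) (hc : g 1 0 = 0)
    (hd : g 1 1 = 1) : g = ModularGroup.T ^ (g 0 1) := by
  ext i j
  rw [ModularGroup.coe_T_zpow]
  fin_cases i <;> fin_cases j <;> simp [ha, hc, hd]

theorem mem_closure_of_lower_left_eq_zero {g : SL(2, ℤ)} (hc : g 1 0 = 0) :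
    g ∈ Subgroup.closure {Tmat, STTTS} := by
  have hT : ModularGroup.T ∈ Subgroup.closure {Tmat, STTTS} :=
    Subgroup.subset_closure (by simp [Tmat_eq_modularGroup_T])
  have hdet : g 0 0 * g 1 1 = 1 := by
    have := g.det_coe
    rw [Matrix.det_fin_two, hc] at this
    linarith
  rcases Int.mul_eq_one_iff_eq_one_or_neg_one.mp hdet with ⟨ha, hd⟩ | ⟨ha, hd⟩
  · rw [eq_T_zpow_of_upper_unipotent ha hc hd]
    exact zpow_mem hT _
  · rw [← neg_mem_closure_iff,
      eq_T_zpow_of_upper_unipotent (g := -g) (by simp [ha]) (by simp [hc]) (by simp [hd])]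
    exact zpow_mem hT _

/-- Euclidean descent on the first column `(a, c)`: if `|c| < 2|a|`, then multiplying on the left by
`T` or its inverse shrinks `|a|`; otherwise multiplying by `S T³ S` or its inverse shrinks `|c|`. -/
theorem mem_closure_of_three_dvd (g : SL(2, ℤ)) (h : 3 ∣ g 1 0) :
    g ∈ Subgroup.closure {Tmat, STTTS} := by
  have hT : Tmat ∈ Subgroup.closure {Tmat, STTTS} := Subgroup.subset_closure (by simp)
  have hV : STTTS ∈ Subgroup.closure {Tmat, STTTS} := Subgroup.subset_closure (by simp)
  induction hn : (g 0 0).natAbs + (g 1 0).natAbs using Nat.strong_induction_on generalizing g with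
  | _ n ih =>
    by_cases hc : g 1 0 = 0
    · exact mem_closure_of_lower_left_eq_zero hc
    have ha : g 0 0 ≠ 0 := by
      intro ha
      have hdet := g.det_coe
      rw [Matrix.det_fin_two, ha, zero_mul, zero_sub] at hdet
      have : (3 : ℤ) ∣ 1 := hdet ▸ (h.mul_left (g 0 1)).neg_right
      omega
    have descend : ∀ k ∈ Subgroup.closure {Tmat, STTTS}, 3 ∣ (k * g) 1 0 →
        ((k * g) 0 0).natAbs + ((k * g) 1 0).natAbs < n →
          g ∈ Subgroup.closure {Tmat, STTTS} := fun k hk hdvd hlt =>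
      (Subgroup.mul_mem_cancel_left _ hk).mp (ih _ hlt (k * g) hdvd rfl)
    have hT0 : (Tmat * g) 0 0 = g 0 0 + g 1 0 := by
      simp [mul_apply_zero, coe_Tmat]
    have hT1 : (Tmat * g) 1 0 = g 1 0 := by
      simp [mul_apply_zero, coe_Tmat]
    have hTi0 : (Tmat⁻¹ * g) 0 0 = g 0 0 - g 1 0 := by
      simp [mul_apply_zero, coe_Tmat, Matrix.adjugate_fin_two_of, sub_eq_add_neg]
    have hTi1 : (Tmat⁻¹ * g) 1 0 = g 1 0 := by
      simp [mul_apply_zero, coe_Tmat, Matrix.adjugate_fin_two_of]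
    have hV0 : (STTTS * g) 0 0 = -g 0 0 := by
      simp [mul_apply_zero, coe_STTTS]
    have hV1 : (STTTS * g) 1 0 = 3 * g 0 0 - g 1 0 := by
      simp [mul_apply_zero, coe_STTTS, sub_eq_add_neg]
    have hVi0 : (STTTS⁻¹ * g) 0 0 = -g 0 0 := by
      simp [mul_apply_zero, coe_STTTS, Matrix.adjugate_fin_two_of]
    have hVi1 : (STTTS⁻¹ * g) 1 0 = -(3 * g 0 0) - g 1 0 := by
      simp [mul_apply_zero, coe_STTTS, Matrix.adjugate_fin_two_of, sub_eq_add_neg]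
    by_cases hlt : (g 1 0).natAbs < 2 * (g 0 0).natAbs <;>
      by_cases hsign : 0 < g 0 0 ↔ 0 < g 1 0
    · exact descend _ (inv_mem hT) (by omega) (by omega)
    · exact descend _ hT (by omega) (by omega)
    · exact descend _ hV (by omega) (by omega)
    · exact descend _ (inv_mem hV) (by omega) (by omega)

/-- The congruence subgroup `Γ₀(3)` is generated by
`T = [[1,1],[0,1]]` and `S T³ S = [[-1,0],[3,-1]]`. -/
theorem statement_4 : Gamma0 3 = Subgroup.closure {Tmat, STTTS} := by
  apply le_antisymm
  · intro g hg
    rw [Gamma0_mem] at hg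
    exact mem_closure_of_three_dvd g ((ZMod.intCast_zmod_eq_zero_iff_dvd _ 3).mp hg)
  · rw [Subgroup.closure_le]
    rintro g (rfl | rfl)
    · exact Gamma0_mem.mpr (by simp [Tmat])
    · exact Gamma0_mem.mpr (by simpa [STTTS] using ZMod.natCast_self 3)
end

section
/- The set 𝒮 of sublattices of the E₆ root lattice L isomorphic to A₂³ has exactly 40 elements, and the Weyl group W(L) acts transitively on 𝒮. -/
/-- The Cartan matrix of type `E₆` (Bourbaki numbering: the chain
`α₁ - α₃ - α₄ - α₅ - α₆` with `α₂` attached to `α₄`). -/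
def cartanE6 : Matrix (Fin 6) (Fin 6) ℤ :=
  !![2, 0, -1, 0, 0, 0;
     0, 2, 0, -1, 0, 0;
     -1, 0, 2, -1, 0, 0;
     0, -1, -1, 2, -1, 0;
     0, 0, 0, -1, 2, -1;
     0, 0, 0, 0, -1, 2]

/-- The bilinear form on the `E₆` root lattice `ℤ⁶` whose Gram matrix on the standard basis
(of simple roots) is the Cartan matrix of type `E₆`. -/
def formE6 (x y : Fin 6 → ℤ) : ℤ := ∑ i, ∑ j, x i * cartanE6 i j * y j

/-- The Gram matrix of the root lattice `A₂³`. -/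
def gramA2Cubed : Matrix (Fin 6) (Fin 6) ℤ :=
  !![2, -1, 0, 0, 0, 0;
     -1, 2, 0, 0, 0, 0;
     0, 0, 2, -1, 0, 0;
     0, 0, -1, 2, 0, 0;
     0, 0, 0, 0, 2, -1;
     0, 0, 0, 0, -1, 2]

/-- A sublattice of the `E₆` root lattice isomorphic to `A₂³`: a subgroup admitting a
`ℤ`-basis `v₁, …, v₆` whose Gram matrix is the block-diagonal matrix with three
`A₂`-blocks. -/
def IsA2Cubed (N : Submodule ℤ (Fin 6 → ℤ)) : Prop :=
  ∃ v : Fin 6 → Fin 6 → ℤ,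
    Submodule.span ℤ (Set.range v) = N ∧ LinearIndependent ℤ v ∧
    ∀ i j, formE6 (v i) (v j) = gramA2Cubed i j

/-- The Weyl group of the `E₆` root lattice: the group generated by the reflections
`s_α(v) = v - (α|v)α` in the roots `α` (the vectors of norm `2`). -/
def WeylE6 : Subgroup ((Fin 6 → ℤ) ≃ₗ[ℤ] (Fin 6 → ℤ)) :=
  Subgroup.closure
    {w | ∃ α : Fin 6 → ℤ, formE6 α α = 2 ∧ ∀ x, w x = x - formE6 α x • α}

/-- The form `formE6` as a bilinear map. -/
def bilinE6 : (Fin 6 → ℤ) →ₗ[ℤ] (Fin 6 → ℤ) →ₗ[ℤ] ℤ := Matrix.toLinearMap₂' ℤ cartanE6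

theorem bilinE6_apply (x y : Fin 6 → ℤ) : bilinE6 x y = formE6 x y := by
  simp [bilinE6, Matrix.toLinearMap₂'_apply, formE6, mul_assoc, mul_comm (y _)]

theorem formE6_comm (x y : Fin 6 → ℤ) : formE6 x y = formE6 y x := by
  simp only [formE6, cartanE6, Fin.sum_univ_six, Matrix.of_apply, Matrix.cons_val]
  ring

/-- The reflection in a root. -/
def rootReflection (α : Fin 6 → ℤ) (hα : formE6 α α = 2) :
    (Fin 6 → ℤ) ≃ₗ[ℤ] (Fin 6 → ℤ) :=
  Module.reflection (x := α) (f := bilinE6 α) (by rw [bilinE6_apply, hα])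

theorem rootReflection_apply (α : Fin 6 → ℤ) (hα : formE6 α α = 2) (x : Fin 6 → ℤ) :
    rootReflection α hα x = x - formE6 α x • α := by
  rw [rootReflection, Module.reflection_apply, bilinE6_apply]

theorem rootReflection_mem_WeylE6 (α : Fin 6 → ℤ) (hα : formE6 α α = 2) :
    rootReflection α hα ∈ WeylE6 :=
  Subgroup.subset_closure ⟨α, hα, rootReflection_apply α hα⟩

theorem formE6_map_of_mem_WeylE6 {w : (Fin 6 → ℤ) ≃ₗ[ℤ] (Fin 6 → ℤ)} (hw : w ∈ WeylE6) :
    ∀ x y, formE6 (w x) (w y) = formE6 x y := by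
  induction hw using Subgroup.closure_induction with
  | mem w hw =>
    obtain ⟨α, hα, h⟩ := hw
    intro x y
    have hxα := formE6_comm x α
    simp only [← bilinE6_apply] at hα h hxα ⊢
    simp only [h, map_sub, map_smul, LinearMap.sub_apply, LinearMap.smul_apply, smul_eq_mul, hα,
      hxα]
    ring
  | one => simp
  | mul a b _ _ ha hb => intro x y; simp [ha, hb]
  | inv a _ ha =>
    intro x y
    rw [← ha]
    exact congrArg₂ formE6 (a.apply_symm_apply x) (a.apply_symm_apply y)

theorem IsA2Cubed.map {N : Submodule ℤ (Fin 6 → ℤ)} (hN : IsA2Cubed N)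
    {w : (Fin 6 → ℤ) ≃ₗ[ℤ] (Fin 6 → ℤ)} (hw : w ∈ WeylE6) :
    IsA2Cubed (N.map (w : (Fin 6 → ℤ) →ₗ[ℤ] (Fin 6 → ℤ))) := by
  obtain ⟨v, hv, hli, hgram⟩ := hN
  refine ⟨fun i => w (v i), ?_, hli.map' (w : (Fin 6 → ℤ) →ₗ[ℤ] (Fin 6 → ℤ)) w.ker, fun i j => ?_⟩
  · rw [← hv, Submodule.map_span, ← Set.range_comp]
    rfl
  · rw [formE6_map_of_mem_WeylE6 hw, hgram]

/-- The sublattice of vectors annihilated modulo `3` by the functional with coordinates `u`. -/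
def modThreeKer (u : Fin 6 → ZMod 3) : Submodule ℤ (Fin 6 → ℤ) :=
  LinearMap.ker (Fintype.linearCombination ℤ u)

theorem mem_modThreeKer {u : Fin 6 → ZMod 3} {x : Fin 6 → ℤ} :
    x ∈ modThreeKer u ↔ ∑ i, (x i : ZMod 3) * u i = 0 := by
  simp [modThreeKer, Fintype.linearCombination_apply]

theorem modThreeKer_neg (u : Fin 6 → ZMod 3) : modThreeKer (-u) = modThreeKer u := by
  ext x
  simp [mem_modThreeKer]

theorem modThreeKer_ne_top {u : Fin 6 → ZMod 3} (hu : u ≠ 0) : modThreeKer u ≠ ⊤ := by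
  intro h
  refine hu (funext fun i => ?_)
  have : Pi.single i 1 ∈ modThreeKer u := h ▸ Submodule.mem_top
  simpa [modThreeKer] using this

/-- The kernels of two functionals agree only if the functionals are proportional. -/
theorem mul_eq_mul_of_modThreeKer_le {u u' : Fin 6 → ZMod 3} (h : modThreeKer u ≤ modThreeKer u')
    (i j : Fin 6) : u j * u' i = u i * u' j := by
  have key : ((u j).val : ℤ) • Pi.single i 1 - ((u i).val : ℤ) • Pi.single j 1 ∈
      modThreeKer u := by
    simp only [modThreeKer, LinearMap.mem_ker, map_sub, map_smul,
      Fintype.linearCombination_apply_single]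
    simp [mul_comm]
  have := h key
  simp only [modThreeKer, LinearMap.mem_ker, map_sub, map_smul,
      Fintype.linearCombination_apply_single] at this
  simpa [sub_eq_zero] using this

/-- The action of the reflection in `α` on functionals modulo `3`. -/
def reflectModThree (α : Fin 6 → ℤ) (u : Fin 6 → ZMod 3) : Fin 6 → ZMod 3 :=
  fun j => u j - (∑ i, (α i : ZMod 3) * u i) * ∑ i, (α i : ZMod 3) * (cartanE6 i j : ZMod 3)

theorem rootReflection_mem_modThreeKer (α : Fin 6 → ℤ) (hα : formE6 α α = 2)
    (u : Fin 6 → ZMod 3) (x : Fin 6 → ℤ) :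
    rootReflection α hα x ∈ modThreeKer u ↔ x ∈ modThreeKer (reflectModThree α u) := by
  rw [mem_modThreeKer, mem_modThreeKer]
  refine iff_of_eq (congrArg (· = 0) ?_)
  have hform : (formE6 α x : ZMod 3) =
      ∑ j, (x j : ZMod 3) * ∑ i, (α i : ZMod 3) * (cartanE6 i j : ZMod 3) := by
    rw [formE6, Finset.sum_comm]
    simp only [Int.cast_sum, Int.cast_mul, Finset.mul_sum]
    exact Finset.sum_congr rfl fun j _ => Finset.sum_congr rfl fun i _ => mul_comm _ _
  simp only [rootReflection_apply, reflectModThree, Pi.sub_apply, Pi.smul_apply, smul_eq_mul,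
    Int.cast_sub, Int.cast_mul, sub_mul, mul_sub, Finset.sum_sub_distrib, mul_assoc,
    mul_left_comm _ (∑ i, (α i : ZMod 3) * u i), ← Finset.mul_sum, ← hform]
  ring

theorem map_rootReflection_modThreeKer (α : Fin 6 → ℤ) (hα : formE6 α α = 2)
    (u : Fin 6 → ZMod 3) :
    (modThreeKer (reflectModThree α u)).map
      (rootReflection α hα : (Fin 6 → ℤ) →ₗ[ℤ] (Fin 6 → ℤ)) = modThreeKer u := by
  ext x
  constructor
  · rintro ⟨y, hy, rfl⟩
    exact (rootReflection_mem_modThreeKer α hα u y).2 hy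
  · intro hx
    refine ⟨(rootReflection α hα).symm x, ?_, LinearEquiv.apply_symm_apply _ x⟩
    rw [SetLike.mem_coe, ← rootReflection_mem_modThreeKer α hα, LinearEquiv.apply_symm_apply]
    exact hx

/-- Three times the Gram matrix of the dual lattice of the `E₆` root lattice. -/
def dualGramE6 : Matrix (Fin 6) (Fin 6) ℕ :=
  !![4, 3, 5, 6, 4, 2;
     3, 6, 6, 9, 6, 3;
     5, 6, 10, 12, 8, 4;
     6, 9, 12, 18, 12, 6;
     4, 6, 8, 12, 10, 5;
     2, 3, 4, 6, 5, 4]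

/-- A nonzero functional modulo `3` on the `E₆` root lattice that is represented by a vector of
the dual lattice whose norm is divisible by `3`. -/
def IsIsotropic (u : Fin 6 → ZMod 3) : Prop :=
  u ≠ 0 ∧ 9 ∣ ∑ i, ∑ j, (u i).val * dualGramE6 i j * (u j).val

instance : DecidablePred IsIsotropic := fun _ => inferInstanceAs (Decidable (_ ∧ _))

/-- The functional has a nonzero coordinate, and the last one is `1`. -/
def IsNormalized (u : Fin 6 → ZMod 3) : Prop :=
  ∃ i, u i = 1 ∧ ∀ j, i < j → u j = 0

instance : DecidablePred IsNormalized := fun u =>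
  inferInstanceAs (Decidable (∃ i, u i = 1 ∧ ∀ j, i < j → u j = 0))

theorem card_isotropic_normalized :
    (Finset.univ.filter fun u => IsIsotropic u ∧ IsNormalized u).card = 40 := by
  decide +kernel

theorem isNormalized_or_neg {u : Fin 6 → ZMod 3} (hu : u ≠ 0) :
    IsNormalized u ∨ IsNormalized (-u) := by
  revert u
  decide +kernel

theorem not_isNormalized_neg {u : Fin 6 → ZMod 3} (hu : IsNormalized u) :
    ¬ IsNormalized (-u) := by
  obtain ⟨i, hi, hi'⟩ := hu
  rintro ⟨j, hj, hj'⟩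
  rcases lt_trichotomy i j with h | rfl | h
  · simp [hi' j h] at hj
  · rw [Pi.neg_apply, hi] at hj
    exact absurd hj (by decide)
  · simpa [hi] using hj' i h

theorem IsIsotropic.neg {u : Fin 6 → ZMod 3} (hu : IsIsotropic u) : IsIsotropic (-u) := by
  revert u
  decide +kernel

theorem modThreeKer_injOn :
    Set.InjOn modThreeKer {u | IsIsotropic u ∧ IsNormalized u} := by
  rintro u ⟨⟨hu, -⟩, hnorm⟩ u' ⟨⟨hu', -⟩, hnorm'⟩ h
  obtain ⟨i, hi⟩ := Function.ne_iff.mp hu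
  have hprop : ∀ j, u' j = (u' i / u i) * u j := fun j => by
    have := mul_eq_mul_of_modThreeKer_le h.le i j
    rw [div_mul_eq_mul_div, eq_div_iff hi]
    linear_combination -this
  have hcases : ∀ c : ZMod 3, c = 0 ∨ c = 1 ∨ c = -1 := by decide
  rcases hcases (u' i / u i) with hc | hc | hc
  · exact absurd (funext fun j => by simp [hprop j, hc]) hu'
  · exact funext fun j => by simp [hprop j, hc]
  · exact absurd ((funext fun j => by simp [hprop j, hc] : u' = -u) ▸ hnorm')
      (not_isNormalized_neg hnorm)

/-- Some roots such that products of two of the corresponding reflections already act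
transitively on the isotropic functionals modulo `3` up to sign. -/
def someRoots : Fin 9 → Fin 6 → ℤ :=
  ![![0, 0, 0, 0, 0, 1],
    ![0, 1, 0, 1, 0, 0],
    ![0, 1, 1, 1, 1, 0],
    ![1, 0, 1, 0, 0, 0],
    ![1, 0, 1, 1, 0, 0],
    ![1, 0, 1, 1, 1, 1],
    ![1, 1, 1, 2, 2, 1],
    ![1, 1, 2, 2, 1, 1],
    ![1, 1, 2, 3, 2, 1]]

theorem formE6_someRoots (a : Fin 9) : formE6 (someRoots a) (someRoots a) = 2 := by
  revert a
  decide +kernel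

theorem exists_reflectModThree_eq {u : Fin 6 → ZMod 3} (hu : IsIsotropic u) :
    ∃ a b, reflectModThree (someRoots b) (reflectModThree (someRoots a) u) = ![1, 2, 1, 2, 2, 2] ∨
      reflectModThree (someRoots b) (reflectModThree (someRoots a) u) = -![1, 2, 1, 2, 2, 2] := by
  revert u
  decide +kernel

theorem exists_map_eq_of_isIsotropic {u u' : Fin 6 → ZMod 3} (hu : IsIsotropic u)
    (hu' : IsIsotropic u') :
    ∃ w ∈ WeylE6, (modThreeKer u).map (w : (Fin 6 → ℤ) →ₗ[ℤ] (Fin 6 → ℤ)) = modThreeKer u' := by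
  have base : ∀ {u}, IsIsotropic u → ∃ w ∈ WeylE6, (modThreeKer ![1, 2, 1, 2, 2, 2]).map
      (w : (Fin 6 → ℤ) →ₗ[ℤ] (Fin 6 → ℤ)) = modThreeKer u := by
    intro u hu
    obtain ⟨a, b, h⟩ := exists_reflectModThree_eq hu
    have hker : modThreeKer (reflectModThree (someRoots b) (reflectModThree (someRoots a) u)) =
        modThreeKer ![1, 2, 1, 2, 2, 2] := by
      rcases h with h | h
      · rw [h]
      · rw [h, modThreeKer_neg]
    refine ⟨rootReflection _ (formE6_someRoots a) * rootReflection _ (formE6_someRoots b),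
      mul_mem (rootReflection_mem_WeylE6 _ _) (rootReflection_mem_WeylE6 _ _), ?_⟩
    rw [← map_rootReflection_modThreeKer _ (formE6_someRoots a) u,
      ← map_rootReflection_modThreeKer _ (formE6_someRoots b) (reflectModThree (someRoots a) u),
      hker, ← Submodule.map_comp]
    rfl
  obtain ⟨w, hw, h⟩ := base hu
  obtain ⟨w', hw', h'⟩ := base hu'
  refine ⟨w' * w⁻¹, mul_mem hw' (inv_mem hw), ?_⟩
  rw [← h, ← h', ← Submodule.map_comp]
  congr 1
  refine LinearMap.ext fun x => ?_
  exact congrArg w' (w.symm_apply_apply x)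

theorem det_cartanE6 : cartanE6.det = 3 := by
  simp [cartanE6, Matrix.det_succ_row_zero, Fin.sum_univ_succ, Fin.succAbove]

theorem det_gramA2Cubed : gramA2Cubed.det = 27 := by
  simp [gramA2Cubed, Matrix.det_succ_row_zero, Fin.sum_univ_succ, Fin.succAbove]

theorem det_sq_of_gram {v : Matrix (Fin 6) (Fin 6) ℤ}
    (hgram : ∀ i j, formE6 (v i) (v j) = gramA2Cubed i j) : v.det ^ 2 = 9 := by
  have h : v * cartanE6 * v.transpose = gramA2Cubed := by
    ext i j
    rw [← hgram, formE6, Finset.sum_comm]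
    simp [Matrix.mul_apply, Finset.sum_mul]
  have hdet := congrArg Matrix.det h
  rw [Matrix.det_mul, Matrix.det_mul, Matrix.det_transpose, det_cartanE6, det_gramA2Cubed] at hdet
  linarith

/-- A basis of a sublattice isomorphic to `A₂³`, made of five simple roots and the lowest root. -/
def basisA2Cubed : Fin 6 → Fin 6 → ℤ :=
  ![![1, 0, 0, 0, 0, 0],
    ![0, 0, 1, 0, 0, 0],
    ![0, 0, 0, 0, 1, 0],
    ![0, 0, 0, 0, 0, 1],
    ![0, 1, 0, 0, 0, 0],
    ![-1, -2, -2, -3, -2, -1]]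

theorem formE6_basisA2Cubed (i j : Fin 6) :
    formE6 (basisA2Cubed i) (basisA2Cubed j) = gramA2Cubed i j := by
  fin_cases i <;> fin_cases j <;> decide

theorem isA2Cubed_span_basisA2Cubed :
    IsA2Cubed (Submodule.span ℤ (Set.range basisA2Cubed)) := by
  refine ⟨_, rfl, Matrix.linearIndependent_rows_of_det_ne_zero (A := basisA2Cubed) fun h => ?_,
    formE6_basisA2Cubed⟩
  have := det_sq_of_gram formE6_basisA2Cubed
  rw [h] at this
  norm_num at this

theorem IsA2Cubed.index_eq {N : Submodule ℤ (Fin 6 → ℤ)} (hN : IsA2Cubed N) :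
    N.toAddSubgroup.index = 3 := by
  obtain ⟨v, rfl, hli, hgram⟩ := hN
  have h := Submodule.natAbs_det_basis_change (Pi.basisFun ℤ (Fin 6)) _ (Module.Basis.span hli)
  have hv : ((↑) ∘ Module.Basis.span hli : Fin 6 → Fin 6 → ℤ) = v :=
    funext fun i => by simp [Module.Basis.span_apply]
  rw [hv, Pi.basisFun_det_apply] at h
  have hsq := det_sq_of_gram (v := v) hgram
  have habs : (Matrix.det v).natAbs = 3 := by
    have : (Matrix.det v).natAbs ^ 2 = 3 ^ 2 := by
      rw [← Int.natAbs_pow, hsq]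
      rfl
    exact Nat.pow_left_injective two_ne_zero this
  rw [← habs]
  exact h.symm

theorem eq_of_le_of_index_eq_three {N K : Submodule ℤ (Fin 6 → ℤ)} (hle : N ≤ K) (hK : K ≠ ⊤)
    (hN : N.toAddSubgroup.index = 3) : N = K := by
  have hle' : N.toAddSubgroup ≤ K.toAddSubgroup := hle
  have hmul := AddSubgroup.relIndex_mul_index hle'
  rw [hN] at hmul
  have hne : K.toAddSubgroup.index ≠ 1 := fun h =>
    hK (Submodule.toAddSubgroup_injective (AddSubgroup.index_eq_one.mp h))
  have h3 : K.toAddSubgroup.index = 3 :=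
    ((Nat.dvd_prime Nat.prime_three).mp ⟨_, by rw [mul_comm, hmul]⟩).resolve_left hne
  have h1 : N.toAddSubgroup.relIndex K.toAddSubgroup = 1 := by
    rw [h3] at hmul
    omega
  exact le_antisymm hle (AddSubgroup.relIndex_eq_one.mp h1)

/-- The functional `(x|·)` modulo `3`. -/
def toFunctional (x : Fin 6 → ℤ) : Fin 6 → ZMod 3 :=
  fun j => ((∑ i, x i * cartanE6 i j : ℤ) : ZMod 3)

theorem mem_modThreeKer_toFunctional {x y : Fin 6 → ℤ} :
    y ∈ modThreeKer (toFunctional x) ↔ (3 : ℤ) ∣ formE6 x y := by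
  rw [mem_modThreeKer]
  refine Iff.trans ?_ (ZMod.intCast_zmod_eq_zero_iff_dvd (formE6 x y) 3)
  rw [formE6, Finset.sum_comm]
  simp only [toFunctional, Int.cast_sum, Int.cast_mul, Finset.mul_sum]
  refine iff_of_eq (congrArg (· = 0) ?_)
  exact Finset.sum_congr rfl fun j _ => Finset.sum_congr rfl fun i _ => by ring

theorem nine_dvd_of_form_eq_zero (w : Fin 6 → ZMod 3)
    (hw : ∑ i, ∑ j, w i * (cartanE6 i j : ZMod 3) * w j = 0) :
    9 ∣ ∑ i, ∑ j, (∑ k, w k * (cartanE6 k i : ZMod 3)).val * dualGramE6 i j *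
      (∑ k, w k * (cartanE6 k j : ZMod 3)).val := by
  revert w
  decide +kernel

theorem dualGramE6_form_ne_two (y : Fin 6 → ZMod 3) :
    ∑ i, ∑ j, y i * (dualGramE6 i j : ZMod 3) * y j ≠ 2 := by
  revert y
  decide +kernel

theorem toFunctional_ne_zero {x : Fin 6 → ℤ} (hx : formE6 x x = 6) : toFunctional x ≠ 0 := by
  intro h
  have hdvd : ∀ j, ∃ y, ∑ i, x i * cartanE6 i j = 3 * y := fun j =>
    (ZMod.intCast_zmod_eq_zero_iff_dvd _ 3).mp (congrFun h j)
  choose y hy using hdvd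
  have hxy : ∀ i, x i = ∑ j, (dualGramE6 i j : ℤ) * y j := by
    have h0 := hy 0
    have h1 := hy 1
    have h2 := hy 2
    have h3 := hy 3
    have h4 := hy 4
    have h5 := hy 5
    simp only [cartanE6, Fin.sum_univ_six, Matrix.of_apply, Matrix.cons_val] at h0 h1 h2 h3 h4 h5
    intro i
    fin_cases i <;> simp [dualGramE6, Fin.sum_univ_six] <;> omega
  have hform : ∑ j, y j * x j = 2 := by
    rw [formE6, Finset.sum_comm] at hx
    have hsum : ∀ j, ∑ i, x i * cartanE6 i j * x j = 3 * (y j * x j) := fun j => by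
      rw [← Finset.sum_mul, hy, mul_assoc]
    rw [Finset.sum_congr rfl fun j _ => hsum j, ← Finset.mul_sum] at hx
    omega
  refine dualGramE6_form_ne_two (fun i => (y i : ZMod 3)) ?_
  have hcast := congrArg (Int.cast : ℤ → ZMod 3) hform
  simp only [hxy, Finset.mul_sum, ← mul_assoc] at hcast
  push_cast at hcast
  exact hcast

theorem isIsotropic_toFunctional {x : Fin 6 → ℤ} (hx : formE6 x x = 6) :
    IsIsotropic (toFunctional x) := by
  refine ⟨toFunctional_ne_zero hx, ?_⟩
  have hzero : ∑ i, ∑ j, (x i : ZMod 3) * (cartanE6 i j : ZMod 3) * (x j : ZMod 3) = 0 := by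
    have hcast := congrArg (Int.cast : ℤ → ZMod 3) hx
    rw [formE6] at hcast
    push_cast at hcast
    rw [hcast]
    rfl
  have h := nine_dvd_of_form_eq_zero (fun i => (x i : ZMod 3)) hzero
  simpa only [toFunctional, Int.cast_sum, Int.cast_mul] using h

theorem IsA2Cubed.exists_isIsotropic {N : Submodule ℤ (Fin 6 → ℤ)} (hN : IsA2Cubed N) :
    ∃ u, IsIsotropic u ∧ modThreeKer u = N := by
  have hindex := hN.index_eq
  obtain ⟨v, rfl, -, hgram⟩ := hN
  have hform : ∀ i, formE6 (v 0 - v 1) (v i) = gramA2Cubed 0 i - gramA2Cubed 1 i := fun i => by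
    rw [← bilinE6_apply, map_sub, LinearMap.sub_apply, bilinE6_apply, bilinE6_apply, hgram, hgram]
  have hnorm : formE6 (v 0 - v 1) (v 0 - v 1) = 6 := by
    rw [← bilinE6_apply, map_sub, bilinE6_apply, bilinE6_apply, hform, hform]
    decide
  have hiso := isIsotropic_toFunctional hnorm
  refine ⟨_, hiso, (eq_of_le_of_index_eq_three ?_ (modThreeKer_ne_top hiso.1) hindex).symm⟩
  rw [Submodule.span_le]
  rintro _ ⟨i, rfl⟩
  rw [SetLike.mem_coe, mem_modThreeKer_toFunctional, hform]
  revert i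
  decide

theorem isA2Cubed_modThreeKer {u : Fin 6 → ZMod 3} (hu : IsIsotropic u) :
    IsA2Cubed (modThreeKer u) := by
  obtain ⟨u', hu', h'⟩ := isA2Cubed_span_basisA2Cubed.exists_isIsotropic
  obtain ⟨w, hw, h⟩ := exists_map_eq_of_isIsotropic hu' hu
  exact h ▸ (h' ▸ isA2Cubed_span_basisA2Cubed).map hw

theorem setOf_isA2Cubed_eq :
    {N | IsA2Cubed N} = modThreeKer '' {u | IsIsotropic u ∧ IsNormalized u} := by
  refine Set.Subset.antisymm (fun N hN => ?_) ?_
  · obtain ⟨u, hu, rfl⟩ := IsA2Cubed.exists_isIsotropic hN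
    rcases isNormalized_or_neg hu.1 with h | h
    · exact ⟨u, ⟨hu, h⟩, rfl⟩
    · exact ⟨-u, ⟨hu.neg, h⟩, modThreeKer_neg u⟩
  · rintro _ ⟨u, hu, rfl⟩
    exact isA2Cubed_modThreeKer hu.1

/-- The set `𝒮` of sublattices of the `E₆` root lattice isomorphic to
`A₂³` has exactly `40` elements, and the Weyl group acts transitively on `𝒮`. -/
theorem statement_7 :
    {N : Submodule ℤ (Fin 6 → ℤ) | IsA2Cubed N}.ncard = 40 ∧
    ∀ N₁ N₂ : Submodule ℤ (Fin 6 → ℤ), IsA2Cubed N₁ → IsA2Cubed N₂ →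
      ∃ w ∈ WeylE6, Submodule.map (w : (Fin 6 → ℤ) →ₗ[ℤ] (Fin 6 → ℤ)) N₁ = N₂ := by
  refine ⟨?_, fun N₁ N₂ h₁ h₂ => ?_⟩
  · rw [setOf_isA2Cubed_eq, modThreeKer_injOn.ncard_image,
      ← card_isotropic_normalized, ← Set.ncard_coe_finset]
    simp
  · obtain ⟨u₁, hu₁, rfl⟩ := h₁.exists_isIsotropic
    obtain ⟨u₂, hu₂, rfl⟩ := h₂.exists_isIsotropic
    exact exists_map_eq_of_isIsotropic hu₁ hu₂
end

section
/- Every sublattice M of the D₄ root lattice L isomorphic to A₁³ is the orthogonal complement in L of a root: there exists a root α of L such that M = {v ∈ L : (α|v) = 0}. -/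
/-- The standard dot product on `ℤ⁴`. -/
def dotZ4 (x y : Fin 4 → ℤ) : ℤ := ∑ i, x i * y i

/-- The `D₄` root lattice: integer vectors with even coordinate sum. -/
def D4Lattice : Submodule ℤ (Fin 4 → ℤ) where
  carrier := {x | Even (∑ i, x i)}
  add_mem' := by
    intro a b ha hb
    simpa [Finset.sum_add_distrib] using ha.add hb
  zero_mem' := by simp
  smul_mem' := by
    intro c x hx
    have h : ∑ i, (c • x) i = c * ∑ i, x i := by
      simp [Finset.mul_sum]
    show Even (∑ i, (c • x) i)
    rw [h]
    exact hx.mul_left c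

/-- If a sum of four integer squares is divisible by `4`, the integers have the same parity. -/
theorem even_sub_of_four_dvd_dotZ4_self {x : Fin 4 → ℤ} (h : 4 ∣ dotZ4 x x) (i j : Fin 4) :
    Even (x i - x j) := by
  have key : ∀ a b c d : ZMod 4, a * a + b * b + c * c + d * d = 0 →
      2 * (a - b) = 0 ∧ 2 * (a - c) = 0 ∧ 2 * (a - d) = 0 := by decide
  have hx : ((dotZ4 x x : ℤ) : ZMod 4) = 0 := (ZMod.intCast_zmod_eq_zero_iff_dvd _ 4).2 h
  simp only [dotZ4, Fin.sum_univ_four] at hx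
  push_cast at hx
  obtain ⟨h1, h2, h3⟩ := key _ _ _ _ hx
  have lift : ∀ a b : ℤ, (2 * ((a : ZMod 4) - b) = 0) → (4 : ℤ) ∣ 2 * (a - b) := fun a b hab =>
    (ZMod.intCast_zmod_eq_zero_iff_dvd _ 4).1 (by push_cast; exact hab)
  have h1 := lift _ _ h1
  have h2 := lift _ _ h2
  have h3 := lift _ _ h3
  rw [Int.even_iff]
  fin_cases i <;> fin_cases j <;> simp only [Fin.zero_eta, Fin.mk_one, Fin.reduceFinMk] <;> omega

/-- An integer vector of norm `8` is twice an integer vector. -/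
theorem exists_eq_two_mul_of_dotZ4_self_eq_eight {x : Fin 4 → ℤ} (h : dotZ4 x x = 8) :
    ∃ y : Fin 4 → ℤ, ∀ i, x i = 2 * y i := by
  have hpar := even_sub_of_four_dvd_dotZ4_self (x := x) (by rw [h]; norm_num)
  have h0 : Even (x 0) := by
    by_contra hodd
    have hodd : ∀ i, Odd (x i) := fun i => by
      have := hpar 0 i
      rw [Int.even_sub] at this
      rw [← Int.not_even_iff_odd]
      tauto
    have hsq : ∀ i, 8 ∣ x i ^ 2 - 1 := fun i => Int.eight_dvd_sq_sub_one_of_odd (hodd i)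
    have := hsq 0
    have := hsq 1
    have := hsq 2
    have := hsq 3
    simp only [dotZ4, Fin.sum_univ_four, ← sq] at h
    omega
  have heven : ∀ i, ∃ k, x i = 2 * k := fun i => by
    have := hpar 0 i
    rw [Int.even_sub] at this
    exact (this.1 h0).two_dvd
  exact ⟨fun i => (heven i).choose, fun i => (heven i).choose_spec⟩

/-- Orthogonal roots of `D₄` have inner products of the same parity with every lattice vector. -/
theorem even_dotZ4_add_of_orthogonal_roots {a b x : Fin 4 → ℤ} (ha : dotZ4 a a = 2)
    (hb : dotZ4 b b = 2) (hab : dotZ4 a b = 0) (hx : x ∈ D4Lattice) :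
    Even (dotZ4 a x + dotZ4 b x) := by
  have hpar := even_sub_of_four_dvd_dotZ4_self (x := a + b) (by
    have : dotZ4 (a + b) (a + b) = dotZ4 a a + dotZ4 b b + 2 * dotZ4 a b := by
      simp only [dotZ4, Fin.sum_univ_four, Pi.add_apply]
      ring
    rw [this, ha, hb, hab]
    norm_num)
  have hsplit : dotZ4 a x + dotZ4 b x =
      (a + b) 0 * ∑ i, x i + ∑ i, ((a + b) i - (a + b) 0) * x i := by
    simp only [dotZ4, Fin.sum_univ_four, Pi.add_apply]
    ring
  rw [hsplit]
  have hx' : Even (∑ i, x i) := hx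
  exact (hx'.mul_left _).add (Finset.even_sum _ fun i _ => (hpar i 0).mul_right _)

/-- A vector of even norm lies in the `D₄` lattice. -/
theorem mem_D4Lattice_of_even_dotZ4_self {x : Fin 4 → ℤ} (h : Even (dotZ4 x x)) :
    x ∈ D4Lattice := by
  change Even (∑ i, x i)
  simp only [dotZ4, Fin.sum_univ_four] at h ⊢
  simpa [Int.even_add, Int.even_mul] using h

/-- Three pairwise orthogonal roots have a common orthogonal root. -/
theorem exists_root_orthogonal {a b c : Fin 4 → ℤ} (ha : dotZ4 a a = 2) (hb : dotZ4 b b = 2)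
    (hc : dotZ4 c c = 2) (hab : dotZ4 a b = 0) (hac : dotZ4 a c = 0) (hbc : dotZ4 b c = 0) :
    ∃ r, dotZ4 r r = 2 ∧ dotZ4 r a = 0 ∧ dotZ4 r b = 0 ∧ dotZ4 r c = 0 := by
  let minor (i j k : Fin 4) : ℤ := a i * (b j * c k - b k * c j) -
    a j * (b i * c k - b k * c i) + a k * (b i * c j - b j * c i)
  let w : Fin 4 → ℤ := ![minor 1 2 3, -minor 0 2 3, minor 0 1 3, -minor 0 1 2]
  have hgram : dotZ4 w w = dotZ4 a a * (dotZ4 b b * dotZ4 c c - dotZ4 b c ^ 2) -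
      dotZ4 a b * (dotZ4 a b * dotZ4 c c - dotZ4 b c * dotZ4 a c) +
      dotZ4 a c * (dotZ4 a b * dotZ4 b c - dotZ4 b b * dotZ4 a c) := by
    simp [w, minor, dotZ4, Fin.sum_univ_four]
    ring
  have hwa : dotZ4 w a = 0 := by
    simp [w, minor, dotZ4, Fin.sum_univ_four]
    ring
  have hwb : dotZ4 w b = 0 := by
    simp [w, minor, dotZ4, Fin.sum_univ_four]
    ring
  have hwc : dotZ4 w c = 0 := by
    simp [w, minor, dotZ4, Fin.sum_univ_four]
    ring
  rw [ha, hb, hc, hab, hac, hbc] at hgram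
  obtain ⟨r, hr⟩ := exists_eq_two_mul_of_dotZ4_self_eq_eight (x := w) (by rw [hgram]; norm_num)
  have hdot : ∀ y, dotZ4 w y = 2 * dotZ4 r y := fun y => by
    simp only [dotZ4, hr, Finset.mul_sum, mul_assoc]
  have hrw : dotZ4 r w = 2 * dotZ4 r r := by
    simp only [dotZ4, hr, Finset.mul_sum]
    exact Finset.sum_congr rfl fun i _ => by ring
  refine ⟨r, ?_, ?_, ?_, ?_⟩
  · have := hdot w
    omega
  · have := hdot a
    omega
  · have := hdot b
    omega
  · have := hdot c
    omega

/-- A vector orthogonal to four pairwise orthogonal roots vanishes. -/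
theorem eq_zero_of_dotZ4_eq_zero {u : Fin 4 → Fin 4 → ℤ} (hroot : ∀ i, dotZ4 (u i) (u i) = 2)
    (horth : ∀ i j, i ≠ j → dotZ4 (u i) (u j) = 0) {x : Fin 4 → ℤ}
    (hx : ∀ i, dotZ4 (u i) x = 0) : x = 0 := by
  have hmul : Matrix.of u * (Matrix.of u).transpose = Matrix.diagonal fun _ => 2 := by
    ext i j
    rw [Matrix.mul_apply, Matrix.diagonal_apply]
    split_ifs with h
    · subst h
      exact hroot i
    · exact horth i j h
  refine Matrix.eq_zero_of_mulVec_eq_zero (M := Matrix.of u) (fun h0 => ?_) (funext hx)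
  have hdet := congrArg Matrix.det hmul
  rw [Matrix.det_mul, h0, Matrix.det_diagonal] at hdet
  norm_num at hdet

/-- Expansion of a vector in a frame of four pairwise orthogonal roots. -/
theorem two_mul_eq_sum_dotZ4_mul {u : Fin 4 → Fin 4 → ℤ} (hroot : ∀ i, dotZ4 (u i) (u i) = 2)
    (horth : ∀ i j, i ≠ j → dotZ4 (u i) (u j) = 0) (x : Fin 4 → ℤ) (k : Fin 4) :
    2 * x k = ∑ i, dotZ4 (u i) x * u i k := by
  have hzero : (fun k => 2 * x k - ∑ i, dotZ4 (u i) x * u i k) = 0 := by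
    refine eq_zero_of_dotZ4_eq_zero hroot horth fun j => ?_
    have hexp : dotZ4 (u j) (fun k => 2 * x k - ∑ i, dotZ4 (u i) x * u i k) =
        2 * dotZ4 (u j) x - ∑ i, dotZ4 (u i) x * dotZ4 (u j) (u i) := by
      generalize hc : (fun i => dotZ4 (u i) x) = c
      have hc' : ∀ i, dotZ4 (u i) x = c i := fun i => congrFun hc i
      simp only [hc']
      rw [← hc' j]
      simp only [dotZ4, Fin.sum_univ_four]
      ring
    rw [hexp, Finset.sum_eq_single j (fun i _ hij => by rw [horth j i hij.symm, mul_zero])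
      (by simp), hroot]
    ring
  have := congrFun hzero k
  simp only [Pi.zero_apply] at this
  omega

/-- Every sublattice `M` of the `D₄` root lattice `L` isomorphic to `A₁³`
(i.e. admitting a `ℤ`-basis of three pairwise orthogonal roots) is the orthogonal complement
in `L` of a root: there is a root `α` of `L` with `M = {v ∈ L : (α|v) = 0}`. -/
theorem statement_8 (M : Submodule ℤ (Fin 4 → ℤ)) (hM : M ≤ D4Lattice)
    (v : Fin 3 → Fin 4 → ℤ)
    (hmem : ∀ i, v i ∈ M)
    (hspan : Submodule.span ℤ (Set.range v) = M)
    (hindep : LinearIndependent ℤ v)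
    (hroot : ∀ i, dotZ4 (v i) (v i) = 2)
    (horth : ∀ i j, i ≠ j → dotZ4 (v i) (v j) = 0) :
    ∃ α ∈ D4Lattice, dotZ4 α α = 2 ∧
      ∀ x, x ∈ M ↔ x ∈ D4Lattice ∧ dotZ4 α x = 0 := by
  subst hspan
  obtain ⟨r, hrr, hr0, hr1, hr2⟩ := exists_root_orthogonal (hroot 0) (hroot 1) (hroot 2)
    (horth 0 1 (by decide)) (horth 0 2 (by decide)) (horth 1 2 (by decide))
  have hrv : ∀ i, dotZ4 r (v i) = 0 := by
    intro i
    fin_cases i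
    exacts [hr0, hr1, hr2]
  have hcomm : ∀ x y, dotZ4 x y = dotZ4 y x := fun x y => by simp only [dotZ4, mul_comm]
  refine ⟨r, mem_D4Lattice_of_even_dotZ4_self (by rw [hrr]; exact even_two), hrr, fun x =>
    ⟨fun hx => ⟨hM hx, ?_⟩, fun ⟨hxL, hrx⟩ => ?_⟩⟩
  · induction hx using Submodule.span_induction with
    | mem y hy =>
      obtain ⟨i, rfl⟩ := hy
      exact hrv i
    | zero => simp [dotZ4]
    | add y z _ _ hy hz =>
      have : dotZ4 r (y + z) = dotZ4 r y + dotZ4 r z := by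
        simp only [dotZ4, Pi.add_apply, mul_add, Finset.sum_add_distrib]
      rw [this, hy, hz, add_zero]
    | smul n y _ hy =>
      have : dotZ4 r (n • y) = n * dotZ4 r y := by
        simp only [dotZ4, Pi.smul_apply, smul_eq_mul, Finset.mul_sum, mul_left_comm]
      rw [this, hy, mul_zero]
  · have heven : ∀ i, ∃ m, dotZ4 (v i) x = 2 * m := fun i => by
      have := even_dotZ4_add_of_orthogonal_roots hrr (hroot i) (hrv i) hxL
      rw [hrx, zero_add] at this
      exact this.two_dvd
    choose m hm using heven
    let u : Fin 4 → Fin 4 → ℤ := Fin.cons r v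
    have hexp := two_mul_eq_sum_dotZ4_mul (u := u)
      (fun i => by
        refine Fin.cases ?_ (fun i => ?_) i
        exacts [hrr, hroot i])
      (fun i j => by
        refine Fin.cases ?_ (fun i => ?_) i <;> refine Fin.cases ?_ (fun j => ?_) j <;> intro hij
        · exact absurd rfl hij
        · exact hrv j
        · exact (hcomm _ _).trans (hrv i)
        · exact horth i j fun h => hij (h ▸ rfl)) x
    have hsum : x = ∑ i, m i • v i := by
      funext k
      have h := hexp k
      rw [Fin.sum_univ_succ] at h
      simp only [u, Fin.cons_zero, Fin.cons_succ, hrx, zero_mul, zero_add, hm, mul_assoc,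
        ← Finset.mul_sum] at h
      simpa using h
    rw [hsum]
    exact Submodule.sum_mem _ fun i _ => Submodule.smul_mem _ _ (hmem i)
end

section
/- The Weyl group W(L) of the D₄ root lattice L acts transitively on the set of sublattices of L isomorphic to A₁³. -/
/-- A sublattice of the `D₄` root lattice isomorphic to `A₁³`: a subgroup admitting a
`ℤ`-basis consisting of three pairwise orthogonal roots. -/
def IsA1Cubed (M : Submodule ℤ (Fin 4 → ℤ)) : Prop :=
  M ≤ D4Lattice ∧ ∃ v : Fin 3 → Fin 4 → ℤ,
    Submodule.span ℤ (Set.range v) = M ∧ LinearIndependent ℤ v ∧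
    (∀ i, dotZ4 (v i) (v i) = 2) ∧ ∀ i j, i ≠ j → dotZ4 (v i) (v j) = 0

/-- The Weyl group of the `D₄` root lattice: the group generated by the reflections
`s_α(v) = v - (α|v)α` in the roots `α` of the lattice. -/
def WeylD4 : Subgroup ((Fin 4 → ℤ) ≃ₗ[ℤ] (Fin 4 → ℤ)) :=
  Subgroup.closure
    {w | ∃ α ∈ D4Lattice, dotZ4 α α = 2 ∧ ∀ x, w x = x - dotZ4 α x • α}

/-- The vectors of norm two in `ℤ⁴`. -/
def rootsD4 : Finset (Fin 4 → ℤ) :=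
  (Fintype.piFinset fun _ => {-1, 0, 1}).filter fun x => dotZ4 x x = 2

theorem mem_rootsD4 {x : Fin 4 → ℤ} : x ∈ rootsD4 ↔ dotZ4 x x = 2 := by
  simp only [rootsD4, Finset.mem_filter, Fintype.mem_piFinset, and_iff_right_iff_imp]
  intro h i
  have h' : x i * x i ≤ 2 := by
    rw [← h]
    exact Finset.single_le_sum (f := fun i => x i * x i) (fun j _ => mul_self_nonneg _)
      (Finset.mem_univ i)
  have h₁ : -1 ≤ x i := by nlinarith
  have h₂ : x i ≤ 1 := by nlinarith
  simp only [Finset.mem_insert, Finset.mem_singleton]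
  omega

/-- The root `e₁ + e₂` of the `D₄` root lattice. -/
def baseRootD4 : Fin 4 → ℤ := ![1, 1, 0, 0]

theorem exists_root_chain : ∀ b ∈ rootsD4, ∃ c ∈ rootsD4, dotZ4 baseRootD4 c = 1 ∧
    ∃ d ∈ rootsD4, dotZ4 c d = 1 ∧ dotZ4 d b = 1 := by
  decide +kernel

/-- Two orthogonal roots orthogonal to `e₁ + e₂` admit a root orthogonal to all three, and this
root determines the three up to sign. -/
theorem exists_root_orthogonal_s9 : ∀ b ∈ rootsD4, dotZ4 baseRootD4 b = 0 →
    ∀ c ∈ rootsD4, dotZ4 baseRootD4 c = 0 → dotZ4 b c = 0 →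
    ∃ d ∈ rootsD4, (dotZ4 d baseRootD4 = 0 ∧ dotZ4 d b = 0 ∧ dotZ4 d c = 0) ∧
      ∀ g ∈ rootsD4, dotZ4 d g = 0 →
        (g = baseRootD4 ∨ g = -baseRootD4) ∨ (g = b ∨ g = -b) ∨ g = c ∨ g = -c := by
  decide +kernel

theorem dotZ4_comm (x y : Fin 4 → ℤ) : dotZ4 x y = dotZ4 y x := by
  simp only [dotZ4, mul_comm]

theorem dotZ4_sub_smul (t : ℤ) (x y z : Fin 4 → ℤ) :
    dotZ4 x (y - t • z) = dotZ4 x y - t * dotZ4 x z := by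
  simp only [dotZ4, Fin.sum_univ_four, Pi.sub_apply, Pi.smul_apply, smul_eq_mul]
  ring

theorem mem_D4Lattice_of_root {a : Fin 4 → ℤ} (ha : dotZ4 a a = 2) : a ∈ D4Lattice := by
  have h : Even (dotZ4 a a) := by simp [ha]
  change Even (∑ i, a i)
  simp only [dotZ4, Fin.sum_univ_four] at h ⊢
  simpa only [Int.even_add, Int.even_mul, or_self] using h

/-- The reflection in a root. -/
def reflectionD4 (a : Fin 4 → ℤ) (ha : dotZ4 a a = 2) : (Fin 4 → ℤ) ≃ₗ[ℤ] (Fin 4 → ℤ) :=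
  LinearEquiv.ofInvolutive
    { toFun := fun x => x - dotZ4 a x • a
      map_add' := fun x y => by
        ext i
        simp only [dotZ4, Fin.sum_univ_four, Pi.sub_apply, Pi.smul_apply, Pi.add_apply,
          smul_eq_mul]
        ring
      map_smul' := fun t x => by
        ext i
        simp only [dotZ4, Fin.sum_univ_four, Pi.sub_apply, Pi.smul_apply, smul_eq_mul,
          RingHom.id_apply]
        ring }
    (fun x => by
      change x - dotZ4 a x • a - dotZ4 a (x - dotZ4 a x • a) • a = x
      rw [dotZ4_sub_smul, ha]
      module)

theorem reflectionD4_apply (a : Fin 4 → ℤ) (ha : dotZ4 a a = 2) (x : Fin 4 → ℤ) :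
    reflectionD4 a ha x = x - dotZ4 a x • a := rfl

theorem reflectionD4_mem_WeylD4 (a : Fin 4 → ℤ) (ha : dotZ4 a a = 2) :
    reflectionD4 a ha ∈ WeylD4 :=
  Subgroup.subset_closure ⟨a, mem_D4Lattice_of_root ha, ha, reflectionD4_apply a ha⟩

theorem dotZ4_map_of_mem_WeylD4 {w : (Fin 4 → ℤ) ≃ₗ[ℤ] (Fin 4 → ℤ)} (hw : w ∈ WeylD4) :
    ∀ x y, dotZ4 (w x) (w y) = dotZ4 x y := by
  induction hw using Subgroup.closure_induction with
  | mem w hw =>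
    obtain ⟨a, -, ha, hwa⟩ := hw
    intro x y
    rw [hwa x, hwa y, dotZ4_sub_smul, dotZ4_comm _ y, dotZ4_comm _ a, dotZ4_sub_smul,
      dotZ4_sub_smul, ha, dotZ4_comm y x, dotZ4_comm y a]
    ring
  | one => exact fun _ _ => rfl
  | mul v w _ _ hv hw => exact fun x y => (hv _ _).trans (hw x y)
  | inv w _ hw =>
    intro x y
    rw [← hw, LinearEquiv.coe_inv, w.apply_symm_apply, w.apply_symm_apply]

/-- The reflection in the difference of two roots at angle `π / 3` exchanges them. -/
theorem exists_WeylD4_map_of_dotZ4_eq_one {a b : Fin 4 → ℤ} (ha : dotZ4 a a = 2)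
    (hb : dotZ4 b b = 2) (hab : dotZ4 a b = 1) : ∃ w ∈ WeylD4, w a = b := by
  have h (x : Fin 4 → ℤ) : dotZ4 (a - b) x = dotZ4 a x - dotZ4 b x := by
    simpa [dotZ4_comm] using dotZ4_sub_smul 1 x a b
  have hba : dotZ4 b a = 1 := dotZ4_comm b a ▸ hab
  have hroot : dotZ4 (a - b) (a - b) = 2 := by
    rw [h, dotZ4_comm a, dotZ4_comm b, h, h]
    lia
  refine ⟨_, reflectionD4_mem_WeylD4 (a - b) hroot, ?_⟩
  rw [reflectionD4_apply, h, ha, hba]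
  module

theorem exists_WeylD4_map_baseRootD4 {b : Fin 4 → ℤ} (hb : dotZ4 b b = 2) :
    ∃ w ∈ WeylD4, w baseRootD4 = b := by
  obtain ⟨c, hc, hac, d, hd, hcd, hdb⟩ := exists_root_chain b (mem_rootsD4.2 hb)
  rw [mem_rootsD4] at hc hd
  obtain ⟨u, hu, rfl⟩ := exists_WeylD4_map_of_dotZ4_eq_one (by decide) hc hac
  obtain ⟨v, hv, rfl⟩ := exists_WeylD4_map_of_dotZ4_eq_one hc hd hcd
  obtain ⟨w, hw, rfl⟩ := exists_WeylD4_map_of_dotZ4_eq_one hd hb hdb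
  exact ⟨w * (v * u), mul_mem hw (mul_mem hv hu), rfl⟩

/-- The sublattice spanned by the roots orthogonal to a given vector. -/
def orthogonalRootSpan (b : Fin 4 → ℤ) : Submodule ℤ (Fin 4 → ℤ) :=
  Submodule.span ℤ {g | dotZ4 g g = 2 ∧ dotZ4 b g = 0}

theorem map_orthogonalRootSpan {w : (Fin 4 → ℤ) ≃ₗ[ℤ] (Fin 4 → ℤ)} (hw : w ∈ WeylD4)
    (b : Fin 4 → ℤ) :
    (orthogonalRootSpan b).map (w : (Fin 4 → ℤ) →ₗ[ℤ] (Fin 4 → ℤ)) =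
      orthogonalRootSpan (w b) := by
  rw [orthogonalRootSpan, Submodule.map_span, orthogonalRootSpan]
  congr 1
  ext g
  obtain ⟨g, rfl⟩ := w.surjective g
  simp [dotZ4_map_of_mem_WeylD4 hw]

theorem exists_span_eq_orthogonalRootSpan {v : Fin 3 → Fin 4 → ℤ} (hbase : v 0 = baseRootD4)
    (hroot : ∀ i, dotZ4 (v i) (v i) = 2) (horth : ∀ i j, i ≠ j → dotZ4 (v i) (v j) = 0) :
    ∃ b, dotZ4 b b = 2 ∧ Submodule.span ℤ (Set.range v) = orthogonalRootSpan b := by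
  have hv (i : Fin 3) : v i ∈ rootsD4 := mem_rootsD4.2 (hroot i)
  have hmem := exists_root_orthogonal_s9
  rw [← hbase] at hmem
  obtain ⟨b, hb, ⟨h0, h1, h2⟩, hmem⟩ := hmem (v 1) (hv 1) (horth 0 1 (by decide))
    (v 2) (hv 2) (horth 0 2 (by decide)) (horth 1 2 (by decide))
  refine ⟨b, mem_rootsD4.1 hb, le_antisymm (Submodule.span_mono ?_) (Submodule.span_le.2 ?_)⟩
  · rintro _ ⟨i, rfl⟩
    refine ⟨hroot i, ?_⟩
    fin_cases i
    exacts [h0, h1, h2]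
  · rintro g ⟨hg, hbg⟩
    have hspan (i : Fin 3) : v i ∈ Submodule.span ℤ (Set.range v) :=
      Submodule.subset_span ⟨i, rfl⟩
    rcases hmem g (mem_rootsD4.2 hg) hbg with (rfl | rfl) | (rfl | rfl) | rfl | rfl
    exacts [hspan 0, neg_mem (hspan 0), hspan 1, neg_mem (hspan 1), hspan 2, neg_mem (hspan 2)]

theorem IsA1Cubed.exists_map_orthogonalRootSpan_eq {M : Submodule ℤ (Fin 4 → ℤ)}
    (hM : IsA1Cubed M) : ∃ w ∈ WeylD4,
      (orthogonalRootSpan baseRootD4).map (w : (Fin 4 → ℤ) →ₗ[ℤ] (Fin 4 → ℤ)) = M := by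
  obtain ⟨-, v, rfl, -, hroot, horth⟩ := hM
  obtain ⟨u, hu, huv⟩ := exists_WeylD4_map_baseRootD4 (hroot 0)
  have hdot (x y : Fin 4 → ℤ) : dotZ4 (u.symm x) (u.symm y) = dotZ4 x y :=
    dotZ4_map_of_mem_WeylD4 (inv_mem hu) x y
  obtain ⟨b, hb, hspan⟩ := exists_span_eq_orthogonalRootSpan (v := fun i => u.symm (v i))
    (by rw [← huv, u.symm_apply_apply]) (fun i => by rw [hdot, hroot])
    (fun i j hij => by rw [hdot, horth i j hij])
  obtain ⟨t, ht, rfl⟩ := exists_WeylD4_map_baseRootD4 hb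
  refine ⟨u * t, mul_mem hu ht, ?_⟩
  rw [map_orthogonalRootSpan (mul_mem hu ht), LinearEquiv.mul_apply,
    ← map_orthogonalRootSpan hu, ← hspan, Submodule.map_span, ← Set.range_comp]
  simp [Function.comp_def]

/-- The Weyl group of the `D₄` root lattice acts transitively on the set
of sublattices isomorphic to `A₁³`. -/
theorem statement_9 (M₁ M₂ : Submodule ℤ (Fin 4 → ℤ))
    (h₁ : IsA1Cubed M₁) (h₂ : IsA1Cubed M₂) :
    ∃ w ∈ WeylD4, Submodule.map (w : (Fin 4 → ℤ) →ₗ[ℤ] (Fin 4 → ℤ)) M₁ = M₂ := by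
  obtain ⟨v, hv, rfl⟩ := h₁.exists_map_orthogonalRootSpan_eq
  obtain ⟨w, hw, rfl⟩ := h₂.exists_map_orthogonalRootSpan_eq
  have hmem : w * v⁻¹ ∈ WeylD4 := mul_mem hw (inv_mem hv)
  refine ⟨w * v⁻¹, hmem, ?_⟩
  rw [map_orthogonalRootSpan hv, map_orthogonalRootSpan hw, map_orthogonalRootSpan hmem,
    LinearEquiv.mul_apply, LinearEquiv.coe_inv, v.symm_apply_apply]
end
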